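/- For all positive integers p and N, there exists a positive integer N* such that the following holds. Let m ≥ 2 be an integer, G a graph, and L an m-list-assignment of G. If (T,X) is a tree-decomposition of G with adhesion at most p such that for every t ∈ V(T) and every subgraph W of the torso at t there exists an L|_{V(W)}-coloring of W with weak diameter in W at most N, then there exists an L-coloring of G with weak diameter in G at most N*. -/

import Mathlib

open SimpleGraph

universe u v

/-- `a` and `b` lie in a common monochromatic component of the coloring `c`
restricted to the set `S` of colored vertices. -/
def MonoReach {β : Type*} {α : Type*} (G : SimpleGraph β) (S : Set β) (c : β → α)
    (a b : β) : Prop :=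
  ∃ w : G.Walk a b, ∀ v ∈ w.support, v ∈ S ∧ c v = c a

/-- The coloring `c` (with domain `S`) has weak diameter in `G` at most `N`. -/
def HasWeakDiamLE {β : Type*} {α : Type*} (G : SimpleGraph β) (S : Set β) (c : β → α)
    (N : ℕ) : Prop :=
  ∀ a b : β, MonoReach G S c a b → G.dist a b ≤ N

/-- `(T, X)` is a tree-decomposition of `G`. -/
def IsTreeDecomp {V : Type*} {ι : Type*} (G : SimpleGraph V) (T : SimpleGraph ι)
    (X : ι → Set V) : Prop :=
  T.IsTree ∧
  (∀ v : V, ∃ t, v ∈ X t) ∧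
  (∀ ⦃a b : V⦄, G.Adj a b → ∃ t, a ∈ X t ∧ b ∈ X t) ∧
  (∀ v : V, (T.induce {t | v ∈ X t}).Connected)

/-- The torso at a node `t` of the tree-decomposition `(T,X)` of `G`: the graph
obtained from `G[X_t]` by adding, for each neighbour `t'` of `t` in `T`, edges making
`X_t ∩ X_{t'}` a clique. -/
def torso {V : Type*} {ι : Type*} (G : SimpleGraph V) (T : SimpleGraph ι)
    (X : ι → Set V) (t : ι) : SimpleGraph ↥(X t) :=
  SimpleGraph.fromRel fun x y =>
    G.Adj (x : V) (y : V) ∨ ∃ t', T.Adj t t' ∧ (x : V) ∈ X t' ∧ (y : V) ∈ X t'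

def Near {V : Type*} (G : SimpleGraph V) (n : ℕ) (a b : V) : Prop :=
  ∃ w : G.Walk a b, w.length ≤ n

namespace Near

variable {V : Type*} {G : SimpleGraph V} {m n : ℕ} {a b c : V}

theorem refl (n : ℕ) (a : V) : Near G n a a := ⟨Walk.nil, by simp⟩

theorem symm (h : Near G n a b) : Near G n b a := by
  obtain ⟨w, hw⟩ := h
  exact ⟨w.reverse, by simpa using hw⟩

theorem trans (h : Near G m a b) (h' : Near G n b c) : Near G (m + n) a c := by
  obtain ⟨w, hw⟩ := h
  obtain ⟨w', hw'⟩ := h'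
  exact ⟨w.append w', by rw [Walk.length_append]; omega⟩

theorem mono (h : Near G m a b) (hmn : m ≤ n) : Near G n a b := by
  obtain ⟨w, hw⟩ := h
  exact ⟨w, hw.trans hmn⟩

theorem of_adj (h : G.Adj a b) : Near G 1 a b := ⟨h.toWalk, by simp⟩

theorem dist_le (h : Near G n a b) : G.dist a b ≤ n := by
  obtain ⟨w, hw⟩ := h
  exact (SimpleGraph.dist_le w).trans hw

theorem of_dist_le (h : G.Reachable a b) (hd : G.dist a b ≤ n) : Near G n a b := by
  obtain ⟨w, hw⟩ := h.exists_walk_length_eq_dist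
  exact ⟨w, by omega⟩

/-- Replacing every edge of a short walk by a short walk in another graph. -/
theorem of_near_adj {H : SimpleGraph V} (hH : ∀ a b, H.Adj a b → Near G n a b)
    (h : Near H m a b) : Near G (m * n) a b := by
  obtain ⟨w, hw⟩ := h
  have key : Near G (w.length * n) a b := by
    clear hw
    induction w with
    | nil => exact refl _ _
    | cons hadj w ih =>
      refine ((hH _ _ hadj).trans ih).mono ?_
      rw [Walk.length_cons, Nat.add_mul]
      omega
  exact key.mono (Nat.mul_le_mul_right _ hw)

end Near

section Cover

variable {V : Type*}

theorem exists_last_of_walk {H : SimpleGraph V} (P : V → Prop) {a b : V} (w : H.Walk a b)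
    (ha : P a) :
    ∃ x, P x ∧ (x = b ∨ ∃ y, H.Adj x y ∧
      ∃ w' : H.Walk y b, ∀ v ∈ w'.support, v ∈ w.support ∧ ¬ P v) := by
  classical
  have key : ∀ {a b : V} (w : H.Walk a b), (∀ v ∈ w.support, ¬ P v) ∨
      ∃ x, P x ∧ (x = b ∨ ∃ y, H.Adj x y ∧
        ∃ w' : H.Walk y b, ∀ v ∈ w'.support, v ∈ w.support ∧ ¬ P v) := by
    intro a b w
    induction w with
    | @nil u =>
      by_cases hu : P u
      · exact Or.inr ⟨u, hu, Or.inl rfl⟩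
      · left
        simpa using hu
    | @cons u v z h w ih =>
      rcases ih with ih | ⟨x, hx, hx'⟩
      · by_cases hu : P u
        · right
          refine ⟨u, hu, Or.inr ⟨v, h, w, fun y hy => ⟨?_, ih y hy⟩⟩⟩
          rw [Walk.support_cons]
          exact List.mem_cons_of_mem _ hy
        · left
          intro y hy
          rw [Walk.support_cons, List.mem_cons] at hy
          rcases hy with rfl | hy
          · exact hu
          · exact ih y hy
      · right
        refine ⟨x, hx, hx'.imp_right ?_⟩
        rintro ⟨y, hy, w', hw'⟩
        refine ⟨y, hy, w', fun q hq => ⟨?_, (hw' q hq).2⟩⟩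
        rw [Walk.support_cons]
        exact List.mem_cons_of_mem _ (hw' q hq).1
  rcases key w with h | h
  · exact absurd ha (h a w.start_mem_support)
  · exact h

/-- A walk with short steps covered by few balls has close ends. -/
theorem near_of_walk_cover {G H : SimpleGraph V} {D r : ℕ}
    (hH : ∀ a b, H.Adj a b → Near G D a b) (S : Finset V) {a b : V} (w : H.Walk a b)
    (hw : ∀ v ∈ w.support, ∃ s ∈ S, Near G r s v) :
    Near G (S.card * (2 * r + D)) a b := by
  classical
  induction hn : S.card generalizing S a with
  | zero =>
    obtain ⟨s, hs, -⟩ := hw a w.start_mem_support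
    rw [Finset.card_eq_zero] at hn
    simp [hn] at hs
  | succ n ih =>
    obtain ⟨s, hs, hsa⟩ := hw a w.start_mem_support
    obtain ⟨x, hx, rfl | ⟨y, hxy, w', hw'⟩⟩ := exists_last_of_walk (fun v => Near G r s v) w hsa
    · exact (hsa.symm.trans hx).mono (by nlinarith [Nat.zero_le (n * (2 * r + D))])
    · have h1 := ih (S.erase s) w' (fun v hv => by
        obtain ⟨s', hs', hv'⟩ := hw v (hw' v hv).1
        refine ⟨s', Finset.mem_erase.2 ⟨?_, hs'⟩, hv'⟩
        rintro rfl
        exact (hw' v hv).2 hv') (by rw [Finset.card_erase_of_mem hs]; omega)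
      refine (((hsa.symm.trans hx).trans (hH _ _ hxy)).trans h1).mono ?_
      nlinarith [Nat.zero_le (n * (2 * r + D))]

theorem near_of_reachable_cover {G H : SimpleGraph V} {D r k : ℕ}
    (hH : ∀ a b, H.Adj a b → Near G D a b) {S : Set V} (hS : S.Finite) (hk : S.ncard ≤ k)
    {a b : V} (hab : H.Reachable a b)
    (hw : ∀ v, H.Reachable a v → ∃ s ∈ S, Near G r s v) :
    Near G (k * (2 * r + D)) a b := by
  classical
  obtain ⟨w⟩ := hab
  refine (near_of_walk_cover hH hS.toFinset w fun v hv => ?_).mono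
    (Nat.mul_le_mul_right _ ((Set.ncard_eq_toFinset_card S hS) ▸ hk))
  obtain ⟨s, hs, h⟩ := hw v ⟨w.takeUntil v hv⟩
  exact ⟨s, hS.mem_toFinset.2 hs, h⟩

end Cover

/-- Induction along the steps of a reachability statement. -/
theorem reachable_induction {V : Type*} {H : SimpleGraph V} {a b : V} {P : V → Prop}
    (h : H.Reachable a b) (ha : P a)
    (hstep : ∀ u v, H.Reachable a u → H.Adj u v → P u → P v) : P b := by
  rw [reachable_iff_reflTransGen] at h
  induction h with
  | refl => exact ha
  | tail h1 h2 ih => exact hstep _ _ ((reachable_iff_reflTransGen _ _).2 h1) h2 ih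

/-- The edges of `G` inside `B` whose ends have the same color. -/
def monoGraph {V α : Type*} (G : SimpleGraph V) (B : Set V) (c : V → α) : SimpleGraph V where
  Adj u v := G.Adj u v ∧ u ∈ B ∧ v ∈ B ∧ c u = c v
  symm := ⟨fun _ _ h => ⟨h.1.symm, h.2.2.1, h.2.1, h.2.2.2.symm⟩⟩
  loopless := ⟨fun _ h => G.loopless.irrefl _ h.1⟩

/-- There is an `L`-coloring of `G` whose monochromatic components have weak diameter at
most `N`. -/
def Good {V : Type*} (G : SimpleGraph V) (L : V → Finset ℕ) (N : ℕ) : Prop :=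
  ∃ c : V → ℕ, (∀ v, c v ∈ L v) ∧
    ∀ a b, (monoGraph G Set.univ c).Reachable a b → Near G N a b

theorem reachable_monoGraph_of_monoReach {V α : Type*} {G : SimpleGraph V} {c : V → α} {a b : V}
    (h : MonoReach G Set.univ c a b) : (monoGraph G Set.univ c).Reachable a b := by
  obtain ⟨w, hw⟩ := h
  induction w with
  | nil => exact Reachable.refl _
  | @cons u v z h w ih =>
    have hv : c v = c u := (hw v (by simp)).2
    have hadj : (monoGraph G Set.univ c).Adj u v := ⟨h, trivial, trivial, hv.symm⟩
    refine hadj.reachable.trans (ih fun y hy => ⟨trivial, ?_⟩)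
    rw [hv]
    refine (hw y ?_).2
    rw [Walk.support_cons]
    exact List.mem_cons_of_mem _ hy

/-- A rooted forest on `ι`, given by a parent function, with bags `X` such that every edge of `G`
lies in a bag and the nodes whose bag contains a given vertex form a subtree. -/
structure RootedDecomp {V ι : Type*} (G : SimpleGraph V) (par : ι → Option ι) (rank : ι → ℕ)
    (X : ι → Set V) : Prop where
  rank_lt : ∀ ⦃t s⦄, par t = some s → rank s < rank t
  mem_par : ∀ ⦃s t v⦄, s ≠ t → rank s ≤ rank t → v ∈ X s → v ∈ X t →
    ∃ u, par t = some u ∧ v ∈ X u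
  edge : ∀ ⦃a b⦄, G.Adj a b → ∃ t, a ∈ X t ∧ b ∈ X t

/-- Every graph spanned by edges of the torso at some node is colorable. -/
def TorsoGood {V ι : Type*} (G : SimpleGraph V) (X : ι → Set V) (L : V → Finset ℕ)
    (N : ℕ) : Prop :=
  ∀ (t : ι) (W : SimpleGraph V), (∀ a b, W.Adj a b → a ∈ X t ∧ b ∈ X t ∧
    (G.Adj a b ∨ ∃ s, s ≠ t ∧ a ∈ X s ∧ b ∈ X s)) → Good W L N

/-- `t` is a descendant of `h` (possibly `h` itself). -/
def Desc {ι : Type*} (par : ι → Option ι) (h t : ι) : Prop :=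
  Relation.ReflTransGen (fun s t => par t = some s) h t

/-- The union of the bags at the descendants of `h`. -/
def below {V ι : Type*} (par : ι → Option ι) (X : ι → Set V) (h : ι) : Set V :=
  {v | ∃ t, Desc par h t ∧ v ∈ X t}

/-- The vertices shared by the bag at `h` and its parent's bag. -/
def adh {V ι : Type*} (par : ι → Option ι) (X : ι → Set V) (h : ι) : Set V :=
  {v | v ∈ X h ∧ ∃ s, par h = some s ∧ v ∈ X s}

/-- The vertices within distance `j` of `S`. -/
def ballAround {V : Type*} (G : SimpleGraph V) (S : Set V) (j : ℕ) : Set V :=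
  {v | ∃ s ∈ S, Near G j s v}

theorem ballAround_mono {V : Type*} {G : SimpleGraph V} {S : Set V} {i j : ℕ} (hij : i ≤ j) :
    ballAround G S i ⊆ ballAround G S j := by
  rintro v ⟨s, hs, h⟩
  exact ⟨s, hs, h.mono hij⟩

theorem subset_ballAround {V : Type*} {G : SimpleGraph V} {S : Set V} (j : ℕ) :
    S ⊆ ballAround G S j := fun v hv => ⟨v, hv, Near.refl _ _⟩

namespace RootedDecomp

variable {V ι : Type*} {G : SimpleGraph V} {par : ι → Option ι} {rank : ι → ℕ} {X : ι → Set V}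

theorem rank_le_of_desc (hd : RootedDecomp G par rank X) {h t : ι} (ht : Desc par h t) :
    rank h ≤ rank t := by
  induction ht with
  | refl => exact le_rfl
  | tail _ h2 ih => exact ih.trans (hd.rank_lt h2).le

theorem desc_par {h t s : ι} (ht : Desc par h t) (hne : t ≠ h)
    (hs : par t = some s) : Desc par h s := by
  rcases Relation.ReflTransGen.cases_tail ht with rfl | ⟨u, hu, hut⟩
  · exact absurd rfl hne
  · rw [hs] at hut
    exact (Option.some.inj hut) ▸ hu

/-- A vertex lying in bags both inside and outside the subtree at `h` lies in the adhesion set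
of `h`. -/
theorem mem_adh (hd : RootedDecomp G par rank X) {h t u : ι} {v : V} (ht : Desc par h t)
    (hu : ¬ Desc par h u) (hvt : v ∈ X t) (hvu : v ∈ X u) : v ∈ adh par X h := by
  induction hn : rank t + rank u using Nat.strong_induction_on generalizing t u with
  | _ n ih =>
    have hne : u ≠ t := by
      rintro rfl
      exact hu ht
    rcases le_total (rank u) (rank t) with hle | hle
    · obtain ⟨s, hs, hvs⟩ := hd.mem_par hne hle hvu hvt
      by_cases hth : t = h
      · subst hth
        exact ⟨hvt, s, hs, hvs⟩
      · exact ih _ (by have := hd.rank_lt hs; omega) (desc_par ht hth hs) hu hvs hvu rfl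
    · obtain ⟨s, hs, hvs⟩ := hd.mem_par hne.symm hle hvt hvu
      refine ih _ (by have := hd.rank_lt hs; omega) ht (fun hh => hu (hh.tail hs)) hvt hvs rfl

/-- An edge with both ends below `h` lies in a bag below `h`. -/
theorem edge_below (hd : RootedDecomp G par rank X) {h : ι} {a b : V} (hab : G.Adj a b)
    (ha : a ∈ below par X h) (hb : b ∈ below par X h) :
    ∃ t, Desc par h t ∧ a ∈ X t ∧ b ∈ X t := by
  obtain ⟨t, hat, hbt⟩ := hd.edge hab
  by_cases ht : Desc par h t
  · exact ⟨t, ht, hat, hbt⟩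
  · obtain ⟨u, hu, hau⟩ := ha
    obtain ⟨u', hu', hbu'⟩ := hb
    exact ⟨h, Relation.ReflTransGen.refl, (hd.mem_adh hu ht hau hat).1,
      (hd.mem_adh hu' ht hbu' hbt).1⟩

theorem ncard_adh_le [Finite V] {k : ℕ}
    (hk : ∀ t s, par t = some s → (X t ∩ X s).ncard ≤ k) (h : ι) :
    (adh par X h).ncard ≤ k := by
  rcases hp : par h with _ | s
  · have : adh par X h = ∅ := by
      ext v
      simp [adh, hp]
    simp [this]
  · refine (Set.ncard_le_ncard ?_ (Set.toFinite _)).trans (hk h s hp)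
    rintro v ⟨hv, s', hs', hv'⟩
    rw [hp] at hs'
    exact ⟨hv, (Option.some.inj hs') ▸ hv'⟩

end RootedDecomp

/-- Colorings of pieces that overlap only where they all agree with `c` can be combined. -/
theorem exists_glue {V ι α : Type*} (P : ι → Prop) (B S : ι → Set V) (c : V → α)
    (f : ι → V → α) (hB : ∀ t t', P t → P t' → t ≠ t' → B t ∩ B t' ⊆ S t)
    (hf : ∀ t, P t → ∀ v ∈ S t, f t v = c v) :
    ∃ g : V → α, (∀ t, P t → ∀ v ∈ B t, g v = f t v) ∧
      (∀ v, (∀ t, P t → v ∈ B t → v ∈ S t) → g v = c v) := by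
  classical
  have key : ∀ v, ∃ a : α, (∀ t, P t → v ∈ B t → a = f t v) ∧
      ((∀ t, P t → v ∈ B t → v ∈ S t) → a = c v) := by
    intro v
    by_cases h : ∃ t, P t ∧ v ∈ B t
    · obtain ⟨t, ht, hv⟩ := h
      refine ⟨f t v, fun t' ht' hv' => ?_, fun h => hf t ht v (h t ht hv)⟩
      by_cases hne : t = t'
      · rw [hne]
      · rw [hf t ht v (hB t t' ht ht' hne ⟨hv, hv'⟩),
          hf t' ht' v (hB t' t ht' ht (Ne.symm hne) ⟨hv', hv⟩)]
    · exact ⟨c v, fun t ht hv => absurd ⟨t, ht, hv⟩ h, fun _ => rfl⟩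
  choose g hg using key
  exact ⟨g, fun t ht v hv => (hg v).1 t ht hv, fun v => (hg v).2⟩

/-- A coloring of the ball of radius `k` around `S` extending `φ` on `S`, in which each of the at
most `k` colors used on `S` is blocked by a layer of the ball. -/
theorem exists_barrier {V : Type*} [Finite V] (G : SimpleGraph V) {L : V → Finset ℕ}
    (hL : ∀ v, 2 ≤ (L v).card) {k : ℕ} {S : Set V} (hS : S.ncard ≤ k) {φ c₀ : V → ℕ}
    (hφ : ∀ v, φ v ∈ L v) (hc₀ : ∀ v, c₀ v ∈ L v) :
    ∃ c : V → ℕ, (∀ v, c v ∈ L v) ∧ (∀ v ∈ S, c v = φ v) ∧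
      (∀ v, v ∉ ballAround G S k → c v = c₀ v) ∧
      ∀ s ∈ S, ∃ j < k, ∀ v, v ∈ ballAround G S (j + 1) → v ∉ ballAround G S j →
        c v ≠ c s := by
  classical
  have hfin : S.Finite := Set.toFinite S
  set l : List V := hfin.toFinset.toList with hl
  have hlen : l.length ≤ k := by
    rw [hl, Finset.length_toList, ← Set.ncard_eq_toFinset_card S hfin]
    exact hS
  let e : ℕ → ℕ := fun j => (l.map φ).getD j 0
  have he : ∀ s ∈ S, ∃ j < k, e j = φ s := by
    intro s hs
    have hmem : s ∈ l := by simpa [hl] using hs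
    obtain ⟨j, hj, hjs⟩ := List.getElem_of_mem hmem
    exact ⟨j, hj.trans_le hlen, by simp [e, hj, hjs]⟩
  have key : ∀ v, ∃ a ∈ L v, (v ∈ S → a = φ v) ∧ (v ∉ ballAround G S k → a = c₀ v) ∧
      ∀ j < k, v ∈ ballAround G S (j + 1) → v ∉ ballAround G S j → a ≠ e j := by
    intro v
    by_cases hvS : v ∈ S
    · exact ⟨φ v, hφ v, fun _ => rfl, fun h => absurd (subset_ballAround k hvS) h,
        fun j _ _ h => absurd (subset_ballAround j hvS) h⟩
    by_cases hv : v ∈ ballAround G S k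
    · have hex : ∃ j, v ∈ ballAround G S j := ⟨k, hv⟩
      obtain ⟨a, ha, hne⟩ := Finset.exists_mem_ne (hL v) (e (Nat.find hex - 1))
      refine ⟨a, ha, fun h => absurd h hvS, fun h => absurd hv h, fun j _ h1 h2 => ?_⟩
      have : Nat.find hex = j + 1 := by
        rw [Nat.find_eq_iff]
        exact ⟨h1, fun i hi h => h2 (ballAround_mono (Nat.lt_succ_iff.1 hi) h)⟩
      rw [this] at hne
      exact hne
    · exact ⟨c₀ v, hc₀ v, fun h => absurd h hvS, fun _ => rfl,
        fun j hj h => absurd (ballAround_mono hj h) hv⟩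
  choose c hc using key
  refine ⟨c, fun v => (hc v).1, fun v => (hc v).2.1, fun v => (hc v).2.2.1, fun s hs => ?_⟩
  obtain ⟨j, hj, hjs⟩ := he s hs
  refine ⟨j, hj, fun v h1 h2 => ?_⟩
  rw [(hc s).2.1 hs, ← hjs]
  exact (hc v).2.2.2 j hj h1 h2

/-- `t` can be reached from its ancestor `h` by steps across adhesion sets meeting `Z`. -/
def Piece {V ι : Type*} (par : ι → Option ι) (X : ι → Set V) (Z : Set V) (h t : ι) : Prop :=
  Relation.ReflTransGen (fun s t => par t = some s ∧ ∃ v ∈ Z, v ∈ X t ∧ v ∈ X s) h t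

/-- `t` is a child of a node of the piece of `h` and does not belong to this piece. -/
def Hang {V ι : Type*} (par : ι → Option ι) (X : ι → Set V) (Z : Set V) (h t : ι) : Prop :=
  ¬ Piece par X Z h t ∧ ∃ s, par t = some s ∧ Piece par X Z h s

section Pieces

variable {V ι : Type*} {G : SimpleGraph V} {par : ι → Option ι} {rank : ι → ℕ} {X : ι → Set V}
  {Z : Set V} {h t t' u : ι}

theorem Piece.desc (ht : Piece par X Z h t) : Desc par h t := by
  induction ht with
  | refl => exact Relation.ReflTransGen.refl
  | tail _ h2 ih => exact ih.tail h2.1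

theorem Hang.desc (ht : Hang par X Z h t) : Desc par h t := by
  obtain ⟨-, s, hs, hps⟩ := ht
  exact hps.desc.tail hs

theorem Hang.rank_lt (ht : Hang par X Z h t) (hd : RootedDecomp G par rank X) :
    rank h < rank t := by
  obtain ⟨-, s, hs, hps⟩ := ht
  exact (hd.rank_le_of_desc hps.desc).trans_lt (hd.rank_lt hs)

theorem piece_or_hang_of_desc (ht : Desc par h t) :
    Piece par X Z h t ∨ ∃ t', Hang par X Z h t' ∧ Desc par t' t := by
  induction ht with
  | refl => exact Or.inl Relation.ReflTransGen.refl
  | @tail b c _ hbc ih =>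
    rcases ih with hb | ⟨t', ht', hb⟩
    · by_cases hc : Piece par X Z h c
      · exact Or.inl hc
      · exact Or.inr ⟨c, ⟨hc, b, hbc, hb⟩, Relation.ReflTransGen.refl⟩
    · exact Or.inr ⟨t', ht', hb.tail hbc⟩

theorem Hang.not_desc_of_piece (ht : Hang par X Z h t) (hd : RootedDecomp G par rank X)
    (hu : Piece par X Z h u) : ¬ Desc par t u := by
  induction hu with
  | refl => exact fun hh => absurd (hd.rank_le_of_desc hh) (not_le.2 (ht.rank_lt hd))
  | @tail b c hb hbc ih =>
    intro hh
    refine ih (RootedDecomp.desc_par hh ?_ hbc.1)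
    rintro rfl
    exact ht.1 (hb.tail hbc)

theorem Hang.eq_of_desc (ht : Hang par X Z h t) (ht' : Hang par X Z h t')
    (hd : RootedDecomp G par rank X) (hh : Desc par t t') : t' = t := by
  by_contra hne
  obtain ⟨-, s, hs, hps⟩ := ht'
  exact ht.not_desc_of_piece hd hps (RootedDecomp.desc_par hh hne hs)

theorem Hang.desc_unique (ht : Hang par X Z h t) (ht' : Hang par X Z h t')
    (hd : RootedDecomp G par rank X) (hu : Desc par t u) (hu' : Desc par t' u) : t = t' := by
  induction hu with
  | refl => exact ht'.eq_of_desc ht hd hu'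
  | @tail b c hb hbc ih =>
    refine ih (RootedDecomp.desc_par hu' ?_ hbc)
    rintro rfl
    have := ht.eq_of_desc ht' hd (hb.tail hbc)
    subst this
    exact absurd (hd.rank_le_of_desc hb) (not_le.2 (hd.rank_lt hbc))

theorem Hang.below_inter_below (ht : Hang par X Z h t) (ht' : Hang par X Z h t')
    (hd : RootedDecomp G par rank X) (hne : t ≠ t') :
    below par X t ∩ below par X t' ⊆ adh par X t := by
  rintro v ⟨⟨s, hs, hvs⟩, ⟨s', hs', hvs'⟩⟩
  exact hd.mem_adh hs (fun hh => hne (ht.desc_unique ht' hd hh hs')) hvs hvs'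

/-- The vertices in the bags of the piece of `h`. -/
def pieceVerts (par : ι → Option ι) (X : ι → Set V) (Z : Set V) (h : ι) : Set V :=
  {v | ∃ t, Piece par X Z h t ∧ v ∈ X t}

theorem Hang.mem_adh_of_mem_pieceVerts (ht : Hang par X Z h t) (hd : RootedDecomp G par rank X)
    {v : V} (hv : v ∈ pieceVerts par X Z h) (hvt : v ∈ below par X t) : v ∈ adh par X t := by
  obtain ⟨s, hs, hvs⟩ := hv
  obtain ⟨s', hs', hvs'⟩ := hvt
  exact hd.mem_adh hs' (ht.not_desc_of_piece hd hs) hvs' hvs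

theorem Hang.not_mem_of_mem_adh (ht : Hang par X Z h t) {v : V} (hv : v ∈ adh par X t) :
    v ∉ Z := by
  obtain ⟨hn, s, hs, hps⟩ := ht
  obtain ⟨hvt, s', hs', hvs⟩ := hv
  rw [hs] at hs'
  cases hs'
  exact fun hvZ => hn (hps.tail ⟨hs, v, hvZ, hvt, hvs⟩)

theorem Hang.exists_piece (ht : Hang par X Z h t) :
    ∃ s, Piece par X Z h s ∧ ∀ v ∈ adh par X t, v ∈ X s := by
  obtain ⟨-, s, hs, hps⟩ := ht
  refine ⟨s, hps, ?_⟩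
  rintro v ⟨-, s', hs', hvs⟩
  rw [hs] at hs'
  cases hs'
  exact hvs

theorem Hang.adh_subset_pieceVerts (ht : Hang par X Z h t) :
    adh par X t ⊆ pieceVerts par X Z h := fun v hv => by
  obtain ⟨s, hs, hvs⟩ := ht.exists_piece
  exact ⟨s, hs, hvs v hv⟩

/-- The graph on the piece of `h` in which, in addition, close vertices in a common hanging
adhesion set are adjacent. -/
def pieceGraph (G : SimpleGraph V) (par : ι → Option ι) (X : ι → Set V) (Z : Set V) (h : ι)
    (D : ℕ) : SimpleGraph V where
  Adj a b := a ≠ b ∧ (∃ t, Piece par X Z h t ∧ a ∈ X t ∧ b ∈ X t) ∧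
    (G.Adj a b ∨ (Near G D a b ∧ ∃ t, Hang par X Z h t ∧ a ∈ adh par X t ∧ b ∈ adh par X t))
  symm := ⟨by
    rintro a b ⟨hne, ⟨t, ht, ha, hb⟩, hab⟩
    refine ⟨hne.symm, ⟨t, ht, hb, ha⟩, hab.imp (fun h => h.symm) ?_⟩
    rintro ⟨hn, t', ht', ha', hb'⟩
    exact ⟨hn.symm, t', ht', hb', ha'⟩⟩
  loopless := ⟨fun _ h => h.1 rfl⟩

/-- The edges of `H` that do not touch `Z`. -/
def avoid (H : SimpleGraph V) (Z : Set V) : SimpleGraph V where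
  Adj a b := H.Adj a b ∧ a ∉ Z ∧ b ∉ Z
  symm := ⟨fun _ _ h => ⟨h.1.symm, h.2.2, h.2.1⟩⟩
  loopless := ⟨fun _ h => H.loopless.irrefl _ h.1⟩

theorem near_of_pieceGraph_adj {D : ℕ} (hD : 1 ≤ D) {a b : V}
    (hab : (pieceGraph G par X Z h D).Adj a b) : Near G D a b := by
  rcases hab.2.2 with hab | hab
  · exact (Near.of_adj hab).mono hD
  · exact hab.1

/-- The piece of `h`, with `Z` removed, has smaller adhesion. -/
theorem good_avoid_pieceGraph [Finite V] {L : V → Finset ℕ} {k N M : ℕ}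
    (hP : ∀ (G : SimpleGraph V) (par : ι → Option ι) (X : ι → Set V),
      RootedDecomp G par rank X → (∀ t s, par t = some s → (X t ∩ X s).ncard < k) →
      TorsoGood G X L N → Good G L M)
    (hd : RootedDecomp G par rank X)
    (hk : ∀ t s, par t = some s → (X t ∩ X s).ncard < k + 1)
    (hN : TorsoGood G X L N) (Z : Set V) (h : ι) (D : ℕ) :
    Good (avoid (pieceGraph G par X Z h D) Z) L M := by
  classical
  let X' : ι → Set V := fun t => {v | Piece par X Z h t ∧ v ∈ X t ∧ v ∉ Z}
  let par' : ι → Option ι := fun t => if Piece par X Z h t ∧ t ≠ h then par t else none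
  have hpar' : ∀ t s, par' t = some s → Piece par X Z h t ∧ t ≠ h ∧ par t = some s := by
    intro t s hs
    by_cases hc : Piece par X Z h t ∧ t ≠ h
    · simp only [par', hc] at hs
      exact ⟨hc.1, hc.2, by simpa [hc.2] using hs⟩
    · simp [par', hc] at hs
  have hparent : ∀ t, Piece par X Z h t → t ≠ h →
      ∃ s, par t = some s ∧ Piece par X Z h s ∧ ∃ v ∈ Z, v ∈ X t ∧ v ∈ X s := by
    intro t ht hne
    rcases Relation.ReflTransGen.cases_tail ht with rfl | ⟨s, hs, hst⟩
    · exact absurd rfl hne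
    · exact ⟨s, hst.1, hs, hst.2⟩
  refine hP _ par' X' ⟨?_, ?_, ?_⟩ ?_ ?_
  · intro t s hs
    exact hd.rank_lt (hpar' t s hs).2.2
  · rintro s t v hne hle ⟨hps, hvs, hvZ⟩ ⟨hpt, hvt, -⟩
    have hth : t ≠ h := by
      rintro rfl
      rcases Relation.ReflTransGen.cases_tail hps.desc with rfl | ⟨w, hw, hws⟩
      · exact hne rfl
      · have := hd.rank_le_of_desc hw
        have := hd.rank_lt hws
        omega
    obtain ⟨u, hu, hvu⟩ := hd.mem_par hne hle hvs hvt
    obtain ⟨u', hu', hpu', -⟩ := hparent t hpt hth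
    rw [hu] at hu'
    cases hu'
    exact ⟨u, by simpa [par', hpt, hth] using hu, hpu', hvu, hvZ⟩
  · rintro a b ⟨⟨-, ⟨t, ht, hat, hbt⟩, -⟩, ha, hb⟩
    exact ⟨t, ⟨ht, hat, ha⟩, ⟨ht, hbt, hb⟩⟩
  · intro t s hs
    obtain ⟨hpt, hne, hts⟩ := hpar' t s hs
    obtain ⟨s', hs', -, z, hz, hzt, hzs⟩ := hparent t hpt hne
    rw [hts] at hs'
    cases hs'
    refine lt_of_lt_of_le (Set.ncard_lt_ncard ?_ (Set.toFinite _))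
      (Nat.lt_succ_iff.1 (hk t s hts))
    refine ⟨fun v hv => ⟨hv.1.2.1, hv.2.2.1⟩, fun hsub => ?_⟩
    exact (hsub ⟨hzt, hzs⟩).1.2.2 hz
  · intro t W hW
    refine hN t W fun a b hab => ?_
    obtain ⟨⟨hpt, ha, -⟩, ⟨-, hb, -⟩, hor⟩ := hW a b hab
    refine ⟨ha, hb, ?_⟩
    rcases hor with ⟨⟨-, -, hG | ⟨-, t', ht', hat, hbt⟩⟩, -⟩ | ⟨s, hst, has, hbs⟩
    · exact Or.inl hG
    · refine Or.inr ⟨t', ?_, hat.1, hbt.1⟩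
      rintro rfl
      exact ht'.1 hpt
    · exact Or.inr ⟨s, hst, has.2.1, hbs.2.1⟩

end Pieces

/-- Recoloring a set covered by few balls of bounded radius keeps the weak diameter bounded. -/
theorem near_of_recolor_ball {V : Type*} [Finite V] {G H : SimpleGraph V} {S : Set V}
    {k D M : ℕ} (hS : S.ncard ≤ k) {c₀ c : V → ℕ}
    (hD : ∀ a b, H.Adj a b → Near G D a b)
    (hc : ∀ v, v ∉ ballAround G S k → c v = c₀ v)
    (hM : ∀ a b, (monoGraph (avoid H (ballAround G S k)) Set.univ c₀).Reachable a b →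
      Near G M a b) {a b : V} (hab : (monoGraph H Set.univ c).Reachable a b) :
    Near G (M + k * (2 * (M + D + k) + D)) a b := by
  set Z := ballAround G S k with hZ
  have hstep : ∀ u v, (monoGraph H Set.univ c).Adj u v → u ∉ Z → v ∉ Z →
      (monoGraph (avoid H Z) Set.univ c₀).Adj u v := by
    intro u v huv hu hv
    refine ⟨⟨huv.1, hu, hv⟩, trivial, trivial, ?_⟩
    rw [← hc u hu, ← hc v hv]
    exact huv.2.2.2
  by_cases hz : ∃ z ∈ Z, (monoGraph H Set.univ c).Reachable a z
  · obtain ⟨z, hzZ, haz⟩ := hz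
    refine (near_of_reachable_cover (D := D) (r := M + D + k) (H := monoGraph H Set.univ c)
      (fun u v huv => hD u v huv.1) (Set.toFinite S) hS hab fun v hv => ?_).mono (Nat.le_add_left _ _)
    have key : (∃ s ∈ S, Near G (M + D + k) s v) ∨
        (z ∉ Z ∧ (monoGraph (avoid H Z) Set.univ c₀).Reachable v z) := by
      refine reachable_induction (P := fun z => (∃ s ∈ S, Near G (M + D + k) s v) ∨
        (z ∉ Z ∧ (monoGraph (avoid H Z) Set.univ c₀).Reachable v z)) (hv.symm.trans haz) ?_ ?_
      · by_cases hvZ : v ∈ Z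
        · obtain ⟨s, hs, hsv⟩ := hvZ
          exact Or.inl ⟨s, hs, hsv.mono (by omega)⟩
        · exact Or.inr ⟨hvZ, Reachable.refl _⟩
      · rintro u w - huw (hu | ⟨huZ, hu⟩)
        · exact Or.inl hu
        · by_cases hwZ : w ∈ Z
          · obtain ⟨s, hs, hsw⟩ := hwZ
            refine Or.inl ⟨s, hs, ?_⟩
            exact (((hM _ _ hu).trans (hD _ _ huw.1)).trans hsw.symm).symm
          · exact Or.inr ⟨hwZ, hu.trans (hstep u w huw huZ hwZ).reachable⟩
    exact key.resolve_right fun hh => hh.1 hzZ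
  · push Not at hz
    refine (hM a b ?_).mono (Nat.le_add_right _ _)
    refine reachable_induction (P := fun v => (monoGraph (avoid H Z) Set.univ c₀).Reachable a v)
      hab (Reachable.refl _) fun u v hu huv hau => ?_
    exact hau.trans (hstep u v huv (fun hh => hz u hh hu)
      (fun hh => hz v hh (hu.trans huv.reachable))).reachable

/-- A bound for the distance between vertices of an adhesion set of size at most `k` that are
joined by a monochromatic path below it. -/
def adhBound (k : ℕ) : ℕ := k * (2 * k + 1) + 1

/-- A bound for the diameter of the monochromatic components of a piece. -/
def pieceBound (k M : ℕ) : ℕ :=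
  M * adhBound k + k * (2 * (M * adhBound k + adhBound k + k) + adhBound k)

/-- The bound for adhesion at most `k`, given the bound `M` for adhesion less than `k`. -/
def stepBound (k M : ℕ) : ℕ := 2 * (pieceBound k M + adhBound k)

/-- The coloring `c` of the subgraph below `h` has weak diameter at most `K`, and its
monochromatic components meeting the adhesion set of `h` stay close to it. -/
def GoodBelow {V ι : Type*} (G : SimpleGraph V) (par : ι → Option ι) (X : ι → Set V)
    (k K : ℕ) (h : ι) (c : V → ℕ) : Prop :=
  (∀ s ∈ adh par X h, ∀ x, (monoGraph G (below par X h) c).Reachable s x →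
    x ∈ ballAround G (adh par X h) k) ∧
  ∀ x y, (monoGraph G (below par X h) c).Reachable x y → Near G K x y

theorem monoGraph_congr {V α : Type*} {G : SimpleGraph V} {B : Set V} {c c' : V → α}
    (hc : ∀ v ∈ B, c v = c' v) : monoGraph G B c = monoGraph G B c' := by
  ext u v
  constructor
  · rintro ⟨h, hu, hv, huv⟩
    exact ⟨h, hu, hv, by rw [← hc u hu, ← hc v hv, huv]⟩
  · rintro ⟨h, hu, hv, huv⟩
    exact ⟨h, hu, hv, by rw [hc u hu, hc v hv, huv]⟩

section Below

variable {V ι : Type*} {G : SimpleGraph V} {par : ι → Option ι} {rank : ι → ℕ} {X : ι → Set V}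
  {k K M : ℕ} {h : ι} {c c' : V → ℕ}

theorem GoodBelow.congr (hg : GoodBelow G par X k K h c')
    (hc : ∀ v ∈ below par X h, c v = c' v) : GoodBelow G par X k K h c := by
  unfold GoodBelow
  rw [monoGraph_congr hc]
  exact hg

theorem GoodBelow.near_of_mem_adh [Finite V] (hg : GoodBelow G par X k K h c)
    (hk : (adh par X h).ncard ≤ k) {s x : V} (hs : s ∈ adh par X h)
    (hx : (monoGraph G (below par X h) c).Reachable s x) : Near G (adhBound k) s x := by
  refine (near_of_reachable_cover (D := 1) (r := k) (H := monoGraph G (below par X h) c)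
    (fun u v huv => Near.of_adj huv.1) (Set.toFinite _) hk hx fun v hv => ?_).mono
    (Nat.le_succ _)
  exact hg.1 s hs v hv

/-- A barrier around the adhesion set confines the monochromatic components meeting it. -/
theorem mem_ballAround_of_barrier (hd : RootedDecomp G par rank X)
    (hbar : ∀ s ∈ adh par X h, ∃ j < k, ∀ v ∈ pieceVerts par X (ballAround G (adh par X h) k) h,
      v ∈ ballAround G (adh par X h) (j + 1) → v ∉ ballAround G (adh par X h) j → c v ≠ c s)
    {s x : V} (hs : s ∈ adh par X h) (hx : (monoGraph G (below par X h) c).Reachable s x) :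
    x ∈ ballAround G (adh par X h) k := by
  obtain ⟨j, hj, hbar⟩ := hbar s hs
  have key : c x = c s ∧ x ∈ ballAround G (adh par X h) j ∧
      x ∈ pieceVerts par X (ballAround G (adh par X h) k) h := by
    refine reachable_induction (P := fun x => c x = c s ∧ x ∈ ballAround G (adh par X h) j ∧
      x ∈ pieceVerts par X (ballAround G (adh par X h) k) h) hx
      ⟨rfl, subset_ballAround j hs, h, Relation.ReflTransGen.refl, hs.1⟩ ?_
    rintro u w - huw ⟨hcu, huj, hup⟩
    have hcw : c w = c s := huw.2.2.2.symm.trans hcu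
    have hwp : w ∈ pieceVerts par X (ballAround G (adh par X h) k) h := by
      obtain ⟨t, ht, hut, hwt⟩ := hd.edge_below huw.1 huw.2.1 huw.2.2.1
      rcases piece_or_hang_of_desc (X := X) (Z := ballAround G (adh par X h) k) ht with
        hp | ⟨t', ht', hdt⟩
      · exact ⟨t, hp, hwt⟩
      · exact absurd (ballAround_mono hj.le huj)
          (ht'.not_mem_of_mem_adh (ht'.mem_adh_of_mem_pieceVerts hd hup ⟨t, hdt, hut⟩))
    have hw1 : w ∈ ballAround G (adh par X h) (j + 1) := by
      obtain ⟨s', hs', hn⟩ := huj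
      exact ⟨s', hs', hn.trans (Near.of_adj huw.1)⟩
    refine ⟨hcw, ?_, hwp⟩
    by_contra hwj
    exact hbar w hwp hw1 hwj hcw
  exact ballAround_mono hj.le key.2.1

/-- A monochromatic component below `h` that meets the piece of `h` at `x` is near the
monochromatic component of `x` in the piece. -/
theorem exists_reachable_piece [Finite V] (hd : RootedDecomp G par rank X)
    (hk : ∀ t, (adh par X t).ncard ≤ k) {Z : Set V}
    (hhang : ∀ t, Hang par X Z h t → GoodBelow G par X k K t c) {x y : V}
    (hx : x ∈ pieceVerts par X Z h) (hxy : (monoGraph G (below par X h) c).Reachable x y) :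
    ∃ s ∈ pieceVerts par X Z h,
      (monoGraph (pieceGraph G par X Z h (adhBound k)) Set.univ c).Reachable x s ∧
      Near G (adhBound k) s y := by
  set H := monoGraph (pieceGraph G par X Z h (adhBound k)) Set.univ c with hH
  have key : ∃ s ∈ pieceVerts par X Z h, H.Reachable x s ∧
      (s = y ∨ (y ∉ pieceVerts par X Z h ∧ ∃ t, Hang par X Z h t ∧ s ∈ adh par X t ∧
        y ∈ below par X t ∧ (monoGraph G (below par X t) c).Reachable s y)) := by
    refine reachable_induction (P := fun y => ∃ s ∈ pieceVerts par X Z h, H.Reachable x s ∧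
      (s = y ∨ (y ∉ pieceVerts par X Z h ∧ ∃ t, Hang par X Z h t ∧ s ∈ adh par X t ∧
        y ∈ below par X t ∧ (monoGraph G (below par X t) c).Reachable s y))) hxy
      ⟨x, hx, Reachable.refl _, Or.inl rfl⟩ ?_
    have hclose : ∀ {t s w}, Hang par X Z h t → s ∈ adh par X t → w ∈ pieceVerts par X Z h →
        w ∈ below par X t → c s = c w → (monoGraph G (below par X t) c).Reachable s w →
        H.Reachable s w := by
      intro t s w ht hs hw hwt hcw hr
      by_cases hsw : s = w
      · rw [hsw]
      · have hwa := ht.mem_adh_of_mem_pieceVerts hd hw hwt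
        obtain ⟨p, hp, hpX⟩ := ht.exists_piece
        refine Adj.reachable ⟨⟨hsw, ⟨p, hp, hpX s hs, hpX w hwa⟩, Or.inr
          ⟨(hhang t ht).near_of_mem_adh (hk t) hs hr, t, ht, hs, hwa⟩⟩, trivial, trivial, hcw⟩
    have hcol : ∀ {B : Set V} {s w}, (monoGraph G B c).Reachable s w → c s = c w := by
      intro B s w hr
      exact reachable_induction (P := fun w => c s = c w) hr rfl
        fun u v _ huv hu => hu.trans huv.2.2.2
    rintro u w - huw ⟨s, hsp, hxs, rfl | ⟨hup, t', ht', hst, hut', hr⟩⟩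
    · obtain ⟨t, ht, hut, hwt⟩ := hd.edge_below huw.1 huw.2.1 huw.2.2.1
      rcases piece_or_hang_of_desc (X := X) (Z := Z) ht with hp | ⟨t', ht', hdt⟩
      · refine ⟨w, ⟨t, hp, hwt⟩, hxs.trans (Adj.reachable ?_), Or.inl rfl⟩
        exact ⟨⟨huw.1.ne, ⟨t, hp, hut, hwt⟩, Or.inl huw.1⟩, trivial, trivial, huw.2.2.2⟩
      · have hst := ht'.mem_adh_of_mem_pieceVerts hd hsp ⟨t, hdt, hut⟩
        have hr : (monoGraph G (below par X t') c).Reachable s w :=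
          Adj.reachable ⟨huw.1, ⟨t, hdt, hut⟩, ⟨t, hdt, hwt⟩, huw.2.2.2⟩
        by_cases hw : w ∈ pieceVerts par X Z h
        · exact ⟨w, hw, hxs.trans (hclose ht' hst hw ⟨t, hdt, hwt⟩ huw.2.2.2 hr), Or.inl rfl⟩
        · exact ⟨s, hsp, hxs, Or.inr ⟨hw, t', ht', hst, ⟨t, hdt, hwt⟩, hr⟩⟩
    · obtain ⟨t, ht, hut, hwt⟩ := hd.edge_below huw.1 huw.2.1 huw.2.2.1
      rcases piece_or_hang_of_desc (X := X) (Z := Z) ht with hp | ⟨t'', ht'', hdt⟩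
      · exact absurd ⟨t, hp, hut⟩ hup
      · have heq : t' = t'' := by
          by_contra hne
          exact hup (ht'.adh_subset_pieceVerts
            (ht'.below_inter_below ht'' hd hne ⟨hut', t, hdt, hut⟩))
        subst heq
        have hr' : (monoGraph G (below par X t') c).Reachable s w :=
          hr.trans (Adj.reachable ⟨huw.1, hut', ⟨t, hdt, hwt⟩, huw.2.2.2⟩)
        by_cases hw : w ∈ pieceVerts par X Z h
        · exact ⟨w, hw, hxs.trans (hclose ht' hst hw ⟨t, hdt, hwt⟩ (hcol hr') hr'), Or.inl rfl⟩
        · exact ⟨s, hsp, hxs, Or.inr ⟨hw, t', ht', hst, ⟨t, hdt, hwt⟩, hr'⟩⟩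
  obtain ⟨s, hs, hxs, rfl | ⟨-, t, ht, hst, -, hr⟩⟩ := key
  · exact ⟨s, hs, hxs, Near.refl _ _⟩
  · exact ⟨s, hs, hxs, (hhang t ht).near_of_mem_adh (hk t) hst hr⟩

/-- A monochromatic component below `h` that avoids the piece of `h` lies below a hanging node. -/
theorem exists_hang_of_not_mem_piece (hd : RootedDecomp G par rank X) {Z : Set V} {x y : V}
    (hx : x ∈ below par X h) (hxy : (monoGraph G (below par X h) c).Reachable x y)
    (hno : ∀ z, (monoGraph G (below par X h) c).Reachable x z → z ∉ pieceVerts par X Z h) :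
    ∃ t, Hang par X Z h t ∧ (monoGraph G (below par X t) c).Reachable x y := by
  obtain ⟨u, hu, hxu⟩ := hx
  rcases piece_or_hang_of_desc (X := X) (Z := Z) hu with hp | ⟨t, ht, hdt⟩
  · exact absurd ⟨u, hp, hxu⟩ (hno x (Reachable.refl _))
  · refine ⟨t, ht, And.right (a := y ∈ below par X t) ?_⟩
    refine reachable_induction (P := fun y => y ∈ below par X t ∧
      (monoGraph G (below par X t) c).Reachable x y) hxy
      ⟨⟨u, hdt, hxu⟩, Reachable.refl _⟩ ?_
    rintro v w hxv hvw ⟨hvt, hr⟩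
    obtain ⟨b, hb, hvb, hwb⟩ := hd.edge_below hvw.1 hvw.2.1 hvw.2.2.1
    rcases piece_or_hang_of_desc (X := X) (Z := Z) hb with hp | ⟨t', ht', hdt'⟩
    · exact absurd ⟨b, hp, hvb⟩ (hno v hxv)
    · have heq : t = t' := by
        by_contra hne
        exact hno v hxv (ht.adh_subset_pieceVerts
          (ht.below_inter_below ht' hd hne ⟨hvt, b, hdt', hvb⟩))
      subst heq
      exact ⟨⟨b, hdt', hwb⟩,
        hr.trans (Adj.reachable ⟨hvw.1, hvt, ⟨b, hdt', hwb⟩, hvw.2.2.2⟩)⟩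

/-- Every coloring of the adhesion set of `h` extends to a good coloring below `h`. -/
theorem exists_goodBelow [Finite V] [Finite ι] {L : V → Finset ℕ} (hL : ∀ v, 2 ≤ (L v).card)
    (hd : RootedDecomp G par rank X) (hk : ∀ t, (adh par X t).ncard ≤ k)
    (hpiece : ∀ (Z : Set V) (h : ι), Good (avoid (pieceGraph G par X Z h (adhBound k)) Z) L M)
    (h : ι) (φ : V → ℕ) (hφ : ∀ v, φ v ∈ L v) :
    ∃ c : V → ℕ, (∀ v, c v ∈ L v) ∧ (∀ v ∈ adh par X h, c v = φ v) ∧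
      GoodBelow G par X k (stepBound k M) h c := by
  obtain ⟨R, hR⟩ : ∃ R, ∀ t, rank t ≤ R := by
    obtain ⟨R, hR⟩ := (Set.finite_range rank).bddAbove
    exact ⟨R, fun t => hR ⟨t, rfl⟩⟩
  induction hn : R - rank h using Nat.strong_induction_on generalizing h φ with
  | _ n ih =>
    set Z := ballAround G (adh par X h) k with hZ
    obtain ⟨c₀, hc₀L, hc₀⟩ := hpiece Z h
    obtain ⟨c₁, hc₁L, hc₁φ, hc₁c₀, hbar⟩ := exists_barrier G hL (hk h) hφ hc₀L
    have hex : ∀ t, ∃ f : V → ℕ, Hang par X Z h t → (∀ v, f v ∈ L v) ∧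
        (∀ v ∈ adh par X t, f v = c₁ v) ∧ GoodBelow G par X k (stepBound k M) t f := by
      intro t
      by_cases ht : Hang par X Z h t
      · have h1 := ht.rank_lt hd
        have h2 := hR t
        obtain ⟨f, hf⟩ := ih (R - rank t) (by omega) t c₁ hc₁L rfl
        exact ⟨f, fun _ => hf⟩
      · exact ⟨c₁, fun hh => absurd hh ht⟩
    choose f hf using hex
    obtain ⟨c, hct, hcc⟩ := exists_glue (Hang par X Z h) (below par X) (adh par X) c₁ f
      (fun t t' ht ht' hne => ht.below_inter_below ht' hd hne) (fun t ht => (hf t ht).2.1)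
    have hcp : ∀ v ∈ pieceVerts par X Z h, c v = c₁ v := fun v hv =>
      hcc v fun t ht hvt => ht.mem_adh_of_mem_pieceVerts hd hv hvt
    have hcL : ∀ v, c v ∈ L v := by
      intro v
      by_cases hv : ∃ t, Hang par X Z h t ∧ v ∈ below par X t
      · obtain ⟨t, ht, hvt⟩ := hv
        rw [hct t ht v hvt]
        exact (hf t ht).1 v
      · rw [hcc v fun t ht hvt => absurd ⟨t, ht, hvt⟩ hv]
        exact hc₁L v
    have hadh : adh par X h ⊆ pieceVerts par X Z h :=
      fun v hv => ⟨h, Relation.ReflTransGen.refl, hv.1⟩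
    have hhang : ∀ t, Hang par X Z h t → GoodBelow G par X k (stepBound k M) t c :=
      fun t ht => (hf t ht).2.2.congr (hct t ht)
    have hnear : ∀ x y, x ∈ pieceVerts par X Z h →
        (monoGraph G (below par X h) c).Reachable x y →
        Near G (pieceBound k M + adhBound k) x y := by
      intro x y hx hxy
      obtain ⟨s, hs, hxs, hsy⟩ := exists_reachable_piece hd hk hhang hx hxy
      have hD : 1 ≤ adhBound k := Nat.le_add_left _ _
      have heq : monoGraph (pieceGraph G par X Z h (adhBound k)) Set.univ c =
          monoGraph (pieceGraph G par X Z h (adhBound k)) Set.univ c₁ := by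
        ext u v
        refine and_congr_right fun ⟨_, ⟨t, ht, hut, hvt⟩, _⟩ => ?_
        rw [hcp u ⟨t, ht, hut⟩, hcp v ⟨t, ht, hvt⟩]
      rw [heq] at hxs
      refine Near.trans ?_ hsy
      refine near_of_recolor_ball (hk h) (fun a b => near_of_pieceGraph_adj hD) hc₁c₀
        (fun a b hab => ?_) hxs
      exact (hc₀ a b hab).of_near_adj (H := avoid (pieceGraph G par X Z h (adhBound k)) Z)
        fun a b hab => near_of_pieceGraph_adj hD hab.1
    refine ⟨c, hcL, fun v hv => (hcp v (hadh hv)).trans (hc₁φ v hv), fun s hs x hx => ?_,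
      fun x y hxy => ?_⟩
    · refine mem_ballAround_of_barrier hd (fun s hs => ?_) hs hx
      obtain ⟨j, hj, hjs⟩ := hbar s hs
      refine ⟨j, hj, fun v hv h1 h2 => ?_⟩
      rw [hcp v hv, hcp s (hadh hs)]
      exact hjs v h1 h2
    · by_cases hx : x ∈ below par X h
      · by_cases hz : ∃ z ∈ pieceVerts par X Z h, (monoGraph G (below par X h) c).Reachable x z
        · obtain ⟨z, hz, hxz⟩ := hz
          refine ((hnear z x hz hxz.symm).symm.trans (hnear z y hz (hxz.symm.trans hxy))).mono ?_
          unfold stepBound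
          omega
        · push Not at hz
          obtain ⟨t, ht, hr⟩ := exists_hang_of_not_mem_piece hd hx hxy
            fun z hxz hzp => hz z hzp hxz
          exact (hhang t ht).2 x y hr
      · have : x = y := reachable_induction (P := fun y => x = y) hxy rfl
          fun u v _ huv hu => absurd (hu ▸ huv.2.1) hx
        exact this ▸ Near.refl _ _

end Below

/-- The bound on the weak diameter obtained for adhesion less than `k`. -/
def decompBound (N : ℕ) : ℕ → ℕ
  | 0 => N
  | k + 1 => stepBound k (decompBound N k)

theorem good_of_disjoint_bags {V ι : Type*} {G : SimpleGraph V} {X : ι → Set V}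
    {L : V → Finset ℕ} {N : ℕ} (hL : ∀ v, 2 ≤ (L v).card)
    (hdisj : ∀ s t v, v ∈ X s → v ∈ X t → s = t)
    (hedge : ∀ a b, G.Adj a b → ∃ t, a ∈ X t ∧ b ∈ X t) (hN : TorsoGood G X L N) :
    Good G L N := by
  classical
  let W : ι → SimpleGraph V := fun t =>
    { Adj := fun a b => G.Adj a b ∧ a ∈ X t ∧ b ∈ X t
      symm := ⟨fun _ _ h => ⟨h.1.symm, h.2.2, h.2.1⟩⟩
      loopless := ⟨fun _ h => G.loopless.irrefl _ h.1⟩ }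
  have hW : ∀ t, Good (W t) L N := fun t =>
    hN t (W t) fun a b hab => ⟨hab.2.1, hab.2.2, Or.inl hab.1⟩
  choose f hfL hf using hW
  have hne : ∀ v, ∃ a, a ∈ L v := fun v =>
    Finset.card_pos.1 (lt_of_lt_of_le Nat.zero_lt_two (hL v))
  choose c₀ hc₀ using hne
  obtain ⟨c, hc, hcc⟩ := exists_glue (fun _ => True) X (fun _ => ∅) c₀ f
    (fun t t' _ _ hne v hv => hne (hdisj t t' v hv.1 hv.2)) (fun t _ v hv => hv.elim)
  refine ⟨c, fun v => ?_, fun a b hab => ?_⟩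
  · by_cases hv : ∃ t, v ∈ X t
    · obtain ⟨t, ht⟩ := hv
      rw [hc t trivial v ht]
      exact hfL t v
    · rw [hcc v fun t _ ht => absurd ⟨t, ht⟩ hv]
      exact hc₀ v
  · by_cases ha : ∃ t, a ∈ X t
    · obtain ⟨t, hat⟩ := ha
      have key : b ∈ X t ∧ (monoGraph (W t) Set.univ (f t)).Reachable a b := by
        refine reachable_induction (P := fun b => b ∈ X t ∧
          (monoGraph (W t) Set.univ (f t)).Reachable a b) hab ⟨hat, Reachable.refl _⟩ ?_
        rintro u w - huw ⟨hut, hr⟩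
        obtain ⟨t', hut', hwt'⟩ := hedge u w huw.1
        cases hdisj t t' u hut hut'
        refine ⟨hwt', hr.trans (Adj.reachable ⟨⟨huw.1, hut, hwt'⟩, trivial, trivial, ?_⟩)⟩
        rw [← hc t trivial u hut, ← hc t trivial w hwt']
        exact huw.2.2.2
      obtain ⟨w, hw⟩ := hf t a b key.2
      have hle : W t ≤ G := fun u v huv => huv.1
      exact ⟨w.mapLe hle, by rwa [Walk.length_map]⟩
    · have : a = b := reachable_induction (P := fun b => a = b) hab rfl fun u v _ huv hu => by
        obtain ⟨t, hut, -⟩ := hedge u v huv.1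
        exact absurd ⟨t, hu ▸ hut⟩ ha
      exact this ▸ Near.refl _ _

theorem exists_root {V ι : Type*} {G : SimpleGraph V} {par : ι → Option ι} {rank : ι → ℕ}
    {X : ι → Set V} (hd : RootedDecomp G par rank X) (t : ι) :
    ∃ h, par h = none ∧ Desc par h t := by
  induction hn : rank t using Nat.strong_induction_on generalizing t with
  | _ n ih =>
    rcases hp : par t with _ | s
    · exact ⟨t, hp, Relation.ReflTransGen.refl⟩
    · obtain ⟨h, hh, hs⟩ := ih _ (by have := hd.rank_lt hp; omega) s rfl
      exact ⟨h, hh, hs.tail hp⟩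

theorem root_unique {ι : Type*} {par : ι → Option ι} {h h' t : ι} (hh : par h = none)
    (hh' : par h' = none) (ht : Desc par h t) (ht' : Desc par h' t) : h = h' := by
  have key : ∀ {h t}, Desc par h t → par t = none → t = h := by
    intro h t ht hp
    rcases Relation.ReflTransGen.cases_tail ht with rfl | ⟨s, -, hs⟩
    · rfl
    · rw [hp] at hs
      cases hs
  induction ht with
  | refl => exact key ht' hh
  | @tail b c hb hbc ih =>
    refine ih (RootedDecomp.desc_par ht' ?_ hbc)
    rintro rfl
    rw [hh'] at hbc
    cases hbc

/-- The coloring theorem for rooted decompositions. -/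
theorem RootedDecomp.good {V ι : Type*} [Finite V] [Finite ι] {L : V → Finset ℕ}
    (hL : ∀ v, 2 ≤ (L v).card) (rank : ι → ℕ) (N k : ℕ) :
    ∀ (G : SimpleGraph V) (par : ι → Option ι) (X : ι → Set V),
      RootedDecomp G par rank X → (∀ t s, par t = some s → (X t ∩ X s).ncard < k) →
      TorsoGood G X L N → Good G L (decompBound N k) := by
  induction k with
  | zero =>
    intro G par X hd hk hN
    refine good_of_disjoint_bags hL (fun s t v hs ht => ?_) hd.edge hN
    by_contra hne
    rcases le_total (rank s) (rank t) with hle | hle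
    · obtain ⟨u, hu, -⟩ := hd.mem_par hne hle hs ht
      exact absurd (hk _ _ hu) (Nat.not_lt_zero _)
    · obtain ⟨u, hu, -⟩ := hd.mem_par (Ne.symm hne) hle ht hs
      exact absurd (hk _ _ hu) (Nat.not_lt_zero _)
  | succ k ih =>
    intro G par X hd hk hN
    have hcard : ∀ t, (adh par X t).ncard ≤ k :=
      ncard_adh_le fun t s hts => Nat.lt_succ_iff.1 (hk t s hts)
    have hne : ∀ v, ∃ a, a ∈ L v := fun v =>
      Finset.card_pos.1 (lt_of_lt_of_le Nat.zero_lt_two (hL v))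
    choose φ hφ using hne
    have hex := fun h => exists_goodBelow hL hd hcard
      (fun Z h => good_avoid_pieceGraph ih hd hk hN Z h (adhBound k)) h φ hφ
    choose f hfL _ hf using hex
    have hadh : ∀ h, par h = none → adh par X h = ∅ := by
      intro h hh
      ext v
      simp [adh, hh]
    have hdisj : ∀ h h', par h = none → par h' = none → h ≠ h' →
        below par X h ∩ below par X h' ⊆ adh par X h := by
      rintro h h' hh hh' hne v ⟨⟨t, ht, hvt⟩, ⟨t', ht', hvt'⟩⟩
      exact hd.mem_adh ht (fun hc => hne (root_unique hh hh' hc ht')) hvt hvt'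
    obtain ⟨c, hc, hcc⟩ := exists_glue (fun h => par h = none) (below par X) (adh par X) φ f
      hdisj (fun h hh v hv => by simp [hadh h hh] at hv)
    refine ⟨c, fun v => ?_, fun a b hab => ?_⟩
    · by_cases hv : ∃ h, par h = none ∧ v ∈ below par X h
      · obtain ⟨h, hh, hvh⟩ := hv
        rw [hc h hh v hvh]
        exact hfL h v
      · rw [hcc v fun h hh hvh => absurd ⟨h, hh, hvh⟩ hv]
        exact hφ v
    · by_cases ha : ∃ t, a ∈ X t
      · obtain ⟨t, hat⟩ := ha
        obtain ⟨h, hh, ht⟩ := exists_root hd t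
        refine ((hf h).congr (hc h hh)).2 a b (And.right (a := b ∈ below par X h) ?_)
        refine reachable_induction (P := fun b => b ∈ below par X h ∧
          (monoGraph G (below par X h) c).Reachable a b) hab
          ⟨⟨t, ht, hat⟩, Reachable.refl _⟩ ?_
        rintro u w - huw ⟨huh, hr⟩
        obtain ⟨t', hut', hwt'⟩ := hd.edge huw.1
        obtain ⟨h', hh', ht'⟩ := exists_root hd t'
        have heq : h = h' := by
          by_contra hne
          have := hdisj h h' hh hh' hne ⟨huh, t', ht', hut'⟩
          simp [hadh h hh] at this
        subst heq
        have hwh : w ∈ below par X h := ⟨t', ht', hwt'⟩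
        exact ⟨hwh, hr.trans (Adj.reachable ⟨huw.1, huh, hwh, huw.2.2.2⟩)⟩
      · have : a = b := reachable_induction (P := fun b => a = b) hab rfl fun u v _ huv hu => by
          obtain ⟨t, hut, -⟩ := hd.edge huv.1
          exact absurd ⟨t, hu ▸ hut⟩ ha
        exact this ▸ Near.refl _ _

section Tree

variable {V ι : Type*} {T : SimpleGraph ι}

/-- A vertex of a tree has at most one neighbor closer to the root. -/
theorem SimpleGraph.IsTree.eq_of_adj_of_dist_lt (hT : T.IsTree) {r x y z : ι}
    (hx : T.Adj x z) (hy : T.Adj y z) (hxr : T.dist r x < T.dist r z)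
    (hyr : T.dist r y < T.dist r z) : x = y := by
  have key : ∀ u, T.Adj u z → T.dist r u < T.dist r z →
      ∃ p : T.Path r z, p.1.penultimate = u := by
    intro u hu hur
    obtain ⟨w, hw⟩ := hT.connected.exists_walk_length_eq_dist r u
    have hlen : (w.concat hu).length = T.dist r z := by
      have h1 := SimpleGraph.dist_le (w.concat hu)
      rw [Walk.length_concat] at h1 ⊢
      omega
    exact ⟨⟨w.concat hu, Walk.isPath_of_length_eq_dist _ hlen⟩, Walk.penultimate_concat _ _⟩
  obtain ⟨p, hp⟩ := key x hx hxr
  obtain ⟨q, hq⟩ := key y hy hyr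
  have := (hT.isAcyclic.subsingleton_path r z).elim p q
  rw [← hp, ← hq, this]

theorem SimpleGraph.IsTree.dist_lt_or_lt (hT : T.IsTree) (r : ι) {x y : ι} (h : T.Adj x y) :
    T.dist r x < T.dist r y ∨ T.dist r y < T.dist r x :=
  lt_or_gt_of_ne (hT.dist_ne_of_adj r h)

/-- A path in a tree whose first step leads away from the root never turns back. -/
theorem SimpleGraph.IsTree.dist_lt_of_isPath (hT : T.IsTree) (r : ι) {x y z : ι}
    (h : T.Adj x y) (q : T.Walk y z) (hp : (Walk.cons h q).IsPath)
    (hxy : T.dist r x < T.dist r y) : T.dist r x < T.dist r z := by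
  induction q generalizing x with
  | nil => exact hxy
  | @cons y w z h' q ih =>
    have hyw : T.dist r y < T.dist r w := by
      refine (hT.dist_lt_or_lt r h').resolve_right fun hlt => ?_
      have hxw := hT.eq_of_adj_of_dist_lt h h'.symm hxy hlt
      rw [Walk.cons_isPath_iff] at hp
      apply hp.2
      rw [hxw]
      simp
    exact hxy.trans (ih h' ((Walk.cons_isPath_iff _ _).1 hp).1 hyw)

/-- Connected sets of nodes of a tree are closed under taking paths. -/
theorem SimpleGraph.IsTree.mem_of_isPath (hT : T.IsTree) {C : Set ι} (hC : (T.induce C).Connected)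
    {s t : ι} (hs : s ∈ C) (ht : t ∈ C) (p : T.Walk s t) (hp : p.IsPath) :
    ∀ u ∈ p.support, u ∈ C := by
  obtain ⟨q, hq⟩ := (hC.preconnected ⟨s, hs⟩ ⟨t, ht⟩).exists_isPath
  let q' : T.Walk s t := q.map (Embedding.induce (G := T) C).toHom
  have hq' : q'.IsPath := hq.map (Embedding.induce (G := T) C).injective
  have heq : p = q' := congrArg Subtype.val
    ((hT.isAcyclic.subsingleton_path s t).elim ⟨p, hp⟩ ⟨q', hq'⟩)
  intro u hu
  rw [heq, show q'.support = _ from Walk.support_map _ q] at hu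
  obtain ⟨x, -, rfl⟩ := List.mem_map.1 hu
  exact x.2

theorem IsTreeDecomp.exists_step {G : SimpleGraph V} {X : ι → Set V}
    (hd : IsTreeDecomp G T X) {s t : ι} (hst : s ≠ t) :
    ∃ u, T.Adj t u ∧ (∀ v, v ∈ X s → v ∈ X t → v ∈ X u) ∧
      ∀ r, T.dist r s ≤ T.dist r t → T.dist r u < T.dist r t := by
  obtain ⟨p, hp⟩ := (hd.1.connected.preconnected t s).exists_isPath
  cases p with
  | nil => exact absurd rfl hst
  | @cons _ u _ h q =>
    refine ⟨u, h, fun v hs ht => ?_, fun r hr => ?_⟩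
    · exact hd.1.mem_of_isPath (hd.2.2.2 v) ht hs _ hp u (by simp)
    · refine (hd.1.dist_lt_or_lt r h).resolve_left fun hlt => ?_
      exact absurd (hd.1.dist_lt_of_isPath r h q hp hlt) (not_lt.2 hr)

/-- Rooting the tree of a tree-decomposition. -/
theorem IsTreeDecomp.exists_rootedDecomp {G : SimpleGraph V} {X : ι → Set V}
    (hd : IsTreeDecomp G T X) :
    ∃ (par : ι → Option ι) (rank : ι → ℕ), RootedDecomp G par rank X ∧
      ∀ t s, par t = some s → T.Adj t s := by
  classical
  obtain ⟨r⟩ := hd.1.connected.nonempty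
  have hex : ∀ t, ∃ o : Option ι, (∀ s, o = some s → T.Adj t s ∧ T.dist r s < T.dist r t) ∧
      (∀ s, T.Adj t s → T.dist r s < T.dist r t → o = some s) := by
    intro t
    by_cases h : ∃ s, T.Adj t s ∧ T.dist r s < T.dist r t
    · obtain ⟨s, hs, hlt⟩ := h
      refine ⟨some s, fun s' hs' => ?_, fun s' hs' hlt' => ?_⟩
      · cases hs'
        exact ⟨hs, hlt⟩
      · rw [hd.1.eq_of_adj_of_dist_lt hs.symm hs'.symm hlt hlt']
    · refine ⟨none, fun s hs => ?_, fun s hs hlt => absurd ⟨s, hs, hlt⟩ h⟩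
      cases hs
  choose par hpar hpar' using hex
  refine ⟨par, T.dist r, ⟨fun t s hs => (hpar t s hs).2, ?_, hd.2.2.1⟩,
    fun t s hs => (hpar t s hs).1⟩
  intro s t v hst hle hs ht
  obtain ⟨u, htu, hu, hlt⟩ := hd.exists_step hst
  exact ⟨u, hpar' t u htu (hlt r hle), hu v hs ht⟩

theorem IsTreeDecomp.torsoGood {G : SimpleGraph V} {X : ι → Set V} {L : V → Finset ℕ} {N : ℕ}
    (hd : IsTreeDecomp G T X) (hL : ∀ v, (L v).Nonempty)
    (hN : ∀ (t : ι) (W : (torso G T X t).Subgraph),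
      ∃ c : ↥W.verts → ℕ, (∀ x : ↥W.verts, c x ∈ L ((x : ↥(X t)) : V)) ∧
        HasWeakDiamLE W.coe Set.univ c N) :
    TorsoGood G X L N := by
  classical
  intro t W hW
  let W' : (torso G T X t).Subgraph :=
    { verts := Set.univ
      Adj := fun a b => W.Adj a b
      adj_sub := by
        intro a b hab
        refine ⟨fun h => hab.ne (congrArg Subtype.val h), Or.inl ?_⟩
        obtain ⟨-, -, h | ⟨s, hst, has, hbs⟩⟩ := hW _ _ hab
        · exact Or.inl h
        · obtain ⟨u, htu, hu, -⟩ := hd.exists_step hst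
          exact Or.inr ⟨u, htu, hu _ has a.2, hu _ hbs b.2⟩
      edge_vert := fun _ => trivial
      symm := ⟨fun _ _ h => h.symm⟩ }
  obtain ⟨c', hc'L, hc'⟩ := hN t W'
  choose φ hφ using hL
  let c : V → ℕ := fun v => if h : v ∈ X t then c' ⟨⟨v, h⟩, trivial⟩ else φ v
  have hc : ∀ v (h : v ∈ X t), c v = c' ⟨⟨v, h⟩, trivial⟩ := fun v h => by simp [c, h]
  refine ⟨c, fun v => ?_, fun a b hab => ?_⟩
  · by_cases h : v ∈ X t
    · rw [hc v h]
      exact hc'L ⟨⟨v, h⟩, trivial⟩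
    · simpa [c, h] using hφ v
  · by_cases ha : a ∈ X t
    · have key : ∃ hb : b ∈ X t, MonoReach W'.coe Set.univ c' ⟨⟨a, ha⟩, trivial⟩
          ⟨⟨b, hb⟩, trivial⟩ := by
        refine reachable_induction (P := fun b => ∃ hb : b ∈ X t, MonoReach W'.coe Set.univ c'
          ⟨⟨a, ha⟩, trivial⟩ ⟨⟨b, hb⟩, trivial⟩) hab ⟨ha, Walk.nil, by simp⟩ ?_
        rintro u w - huw ⟨hu, p, hp⟩
        obtain ⟨-, hw, -⟩ := hW u w huw.1
        have hadj : W'.coe.Adj ⟨⟨u, hu⟩, trivial⟩ ⟨⟨w, hw⟩, trivial⟩ := huw.1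
        refine ⟨hw, p.concat hadj, fun v hv => ⟨trivial, ?_⟩⟩
        rcases (List.mem_append.1 (Walk.support_concat p hadj ▸ hv)).imp_right
          List.mem_singleton.1 with hv | rfl
        · exact (hp v hv).2
        · rw [← (hp _ p.end_mem_support).2, ← hc w hw, ← hc u hu]
          exact huw.2.2.2.symm
      obtain ⟨hb, hr⟩ := key
      obtain ⟨p, hp⟩ := Near.of_dist_le ⟨hr.choose⟩ (hc' _ _ hr)
      let f : W'.coe →g W := ⟨fun x => x.1.1, fun h => h⟩
      exact ⟨p.map f, by rwa [Walk.length_map]⟩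
    · have : a = b := reachable_induction (P := fun b => a = b) hab rfl
        fun u v _ huv hu => absurd (hu ▸ (hW u v huv.1).1) ha
      exact this ▸ Near.refl _ _

end Tree

/-- **Lemma.** For all positive integers `p` and `N`, there exists a positive integer
`N*` such that the following holds. Let `m ≥ 2` be an integer, `G` a graph, and `L` an
`m`-list-assignment of `G`. If `(T,X)` is a tree-decomposition of `G` with adhesion at
most `p` such that for every node `t` and every subgraph `W` of the torso at `t` there
exists an `L|_{V(W)}`-coloring of `W` with weak diameter in `W` at most `N`, then there
exists an `L`-coloring of `G` with weak diameter in `G` at most `N*`. -/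
theorem color_torso (p N : ℕ) (hp : 0 < p) (hN : 0 < N) :
    ∃ Nstar : ℕ, 0 < Nstar ∧
      ∀ m : ℕ, 2 ≤ m →
      ∀ (V : Type u) (ι : Type v) [Fintype V] [Fintype ι],
      ∀ (G : SimpleGraph V) (L : V → Finset ℕ) (T : SimpleGraph ι) (X : ι → Set V),
        (∀ x, (L x).Nonempty) →
        (∀ x, (L x).card = m) →
        IsTreeDecomp G T X →
        (∀ ⦃t t' : ι⦄, T.Adj t t' → (X t ∩ X t').ncard ≤ p) →
        (∀ (t : ι) (W : (torso G T X t).Subgraph),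
          ∃ c : ↥W.verts → ℕ, (∀ x : ↥W.verts, c x ∈ L ((x : ↥(X t)) : V)) ∧
            HasWeakDiamLE W.coe Set.univ c N) →
        ∃ c : V → ℕ, (∀ x, c x ∈ L x) ∧ HasWeakDiamLE G Set.univ c Nstar := by
  refine ⟨decompBound N (p + 1) + 1, Nat.succ_pos _, ?_⟩
  intro m hm V ι _ _ G L T X hne hcard hd hadh hN
  obtain ⟨par, rank, hrd, hpar⟩ := hd.exists_rootedDecomp
  obtain ⟨c, hcL, hc⟩ := RootedDecomp.good (fun v => (hcard v).symm ▸ hm) rank N (p + 1) G par X hrd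
    (fun t s hts => Nat.lt_succ_of_le (hadh (hpar t s hts))) (hd.torsoGood hne hN)
  exact ⟨c, hcL, fun a b hab =>
    (hc a b (reachable_monoGraph_of_monoReach hab)).dist_le.trans (Nat.le_succ _)⟩
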